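/- arXiv:1208.6280 — 2 statements merged into one kernel-verified Lean document; each statement's English description precedes it below -/
import Mathlib

section
/- (Proposition: local constancy of orbital integrals along the section, direct part) Let f : M_{n+1}(F) → ℂ be a smooth compactly supported function whose support is contained in M_{n+1,+}. Then for every (a,b) ∈ F^n × F^{n+1} the function GL_n(F) → ℂ, h ↦ f(h·σ(a,b))·η(det h), is absolutely μ-integrable, and the function φ_f : F^n × F^{n+1} → ℂ defined by φ_f(a,b) := ∫_{GL_n(F)} f(h·σ(a,b))·η(det h) dμ(h) is locally constant and compactly supported. -/
open Matrix MeasureTheory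

namespace ZhangRTF

variable {F : Type*} [Field F] {n : ℕ}

/-- Block diagonal embedding `diag(h,1) ∈ M_{n+1}(F)` of `h ∈ M_n(F)`. -/
def emb (h : Matrix (Fin n) (Fin n) F) : Matrix (Fin (n + 1)) (Fin (n + 1)) F :=
  Matrix.of fun i j =>
    if hi : (i : ℕ) < n then
      (if hj : (j : ℕ) < n then h ⟨i, hi⟩ ⟨j, hj⟩ else 0)
    else (if (j : ℕ) < n then 0 else 1)

/-- Conjugation action of `GL_n(F)` on `M_{n+1}(F)`: `h·X = diag(h,1) X diag(h,1)⁻¹`. -/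
def act (h : Matrix.GeneralLinearGroup (Fin n) F)
    (X : Matrix (Fin (n + 1)) (Fin (n + 1)) F) : Matrix (Fin (n + 1)) (Fin (n + 1)) F :=
  emb (h : Matrix (Fin n) (Fin n) F) * X *
    emb ((h⁻¹ : Matrix.GeneralLinearGroup (Fin n) F) : Matrix (Fin n) (Fin n) F)

/-- The upper-left `n × n` block `A` of `X = [[A,u],[v,w]]`. -/
def blockA (X : Matrix (Fin (n + 1)) (Fin (n + 1)) F) : Matrix (Fin n) (Fin n) F :=
  Matrix.of fun i j => X i.castSucc j.castSucc

/-- The upper-right column `u` of `X = [[A,u],[v,w]]`. -/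
def blockU (X : Matrix (Fin (n + 1)) (Fin (n + 1)) F) : Fin n → F :=
  fun i => X i.castSucc (Fin.last n)

/-- The lower-left row `v` of `X = [[A,u],[v,w]]`. -/
def blockV (X : Matrix (Fin (n + 1)) (Fin (n + 1)) F) : Fin n → F :=
  fun j => X (Fin.last n) j.castSucc

/-- The lower-right corner `w` of `X = [[A,u],[v,w]]`. -/
def blockW (X : Matrix (Fin (n + 1)) (Fin (n + 1)) F) : F :=
  X (Fin.last n) (Fin.last n)

/-- `δ₊(X)`: the matrix whose `j`-th column is `A^{n-j} u` (`1 ≤ j ≤ n`, 1-indexed). -/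
def deltaPlus (X : Matrix (Fin (n + 1)) (Fin (n + 1)) F) : Matrix (Fin n) (Fin n) F :=
  Matrix.of fun i j => (blockA X ^ (n - 1 - (j : ℕ)) *ᵥ blockU X) i

/-- `δ₋(X)`: the matrix whose `i`-th row is `v A^{i-1}` (`1 ≤ i ≤ n`, 1-indexed). -/
def deltaMinus (X : Matrix (Fin (n + 1)) (Fin (n + 1)) F) : Matrix (Fin n) (Fin n) F :=
  Matrix.of fun i j => (blockV X ᵥ* blockA X ^ (i : ℕ)) j

/-- `Δ₊(X) = det δ₊(X)`. -/
def DeltaPlus (X : Matrix (Fin (n + 1)) (Fin (n + 1)) F) : F := (deltaPlus X).det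

/-- `Δ₋(X) = det δ₋(X)`. -/
def DeltaMinus (X : Matrix (Fin (n + 1)) (Fin (n + 1)) F) : F := (deltaMinus X).det

/-- The `a`-invariants: `a_i = -(coefficient of T^{n-i} in charpoly A)` (1-indexed). -/
noncomputable def aInv (X : Matrix (Fin (n + 1)) (Fin (n + 1)) F) : Fin n → F :=
  fun i => -((blockA X).charpoly.coeff (n - 1 - (i : ℕ)))

/-- The `b`-invariants: `b_0 = w` and `b_j = v A^{j-1} u` for `1 ≤ j ≤ n`. -/
def bInv (X : Matrix (Fin (n + 1)) (Fin (n + 1)) F) : Fin (n + 1) → F :=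
  fun j => if (j : ℕ) = 0 then blockW X
    else blockV X ⬝ᵥ (blockA X ^ ((j : ℕ) - 1) *ᵥ blockU X)

/-- The invariants map `π : M_{n+1}(F) → F^n × F^{n+1}`. -/
noncomputable def invMap (X : Matrix (Fin (n + 1)) (Fin (n + 1)) F) : (Fin n → F) × (Fin (n + 1) → F) :=
  (aInv X, bInv X)

/-- The regular nilpotent `ξ₊`: `(i,i+1)`-entries equal to `1`, all others `0`. -/
def xiPlus (n : ℕ) : Matrix (Fin (n + 1)) (Fin (n + 1)) F :=
  Matrix.of fun i j => if (j : ℕ) = (i : ℕ) + 1 then 1 else 0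

/-- The section `σ(a,b)` of the invariants map. -/
def sectSigma (a : Fin n → F) (b : Fin (n + 1) → F) : Matrix (Fin (n + 1)) (Fin (n + 1)) F :=
  Matrix.of fun i j =>
    if hi : (i : ℕ) < n then
      (if (j : ℕ) = 0 then a ⟨i, hi⟩ else 0) + (if (j : ℕ) = (i : ℕ) + 1 then 1 else 0)
    else b j.rev

/-- The variant section `σ'(a,b)`. -/
def sectSigma' (a : Fin n → F) (b : Fin (n + 1) → F) : Matrix (Fin (n + 1)) (Fin (n + 1)) F :=
  Matrix.of fun i j =>
    if (i : ℕ) < n - 1 then (if (j : ℕ) = (i : ℕ) + 1 then 1 else 0)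
    else if (i : ℕ) = n - 1 then
      (if hj : (j : ℕ) < n then a ⟨n - 1 - (j : ℕ), by omega⟩ else 1)
    else b j.rev

/-- Membership in `N_{n,-}`: lower triangular with unit diagonal. -/
def IsLowerUni (h : Matrix (Fin n) (Fin n) F) : Prop :=
  (∀ i, h i i = 1) ∧ ∀ i j : Fin n, i < j → h i j = 0

/-- Membership in `N_n`: upper triangular with unit diagonal. -/
def IsUpperUni (h : Matrix (Fin n) (Fin n) F) : Prop :=
  (∀ i, h i i = 1) ∧ ∀ i j : Fin n, j < i → h i j = 0

/-- Membership in the subvariety `𝒲`: superdiagonal entries `1`,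
entries above the superdiagonal `0`. -/
def memW (X : Matrix (Fin (n + 1)) (Fin (n + 1)) F) : Prop :=
  ∀ i j : Fin (n + 1),
    ((j : ℕ) = (i : ℕ) + 1 → X i j = 1) ∧ ((i : ℕ) + 1 < (j : ℕ) → X i j = 0)

/-- `p : 𝒲 → 𝒱`, replacing the last row by zero. -/
def pMap (X : Matrix (Fin (n + 1)) (Fin (n + 1)) F) : Matrix (Fin (n + 1)) (Fin (n + 1)) F :=
  Matrix.of fun i j => if (i : ℕ) = n then 0 else X i j

/-- `p' : 𝒲 → 𝒱'`, replacing the last row and the first column by zero. -/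
def pMap' (X : Matrix (Fin (n + 1)) (Fin (n + 1)) F) : Matrix (Fin (n + 1)) (Fin (n + 1)) F :=
  Matrix.of fun i j => if (i : ℕ) = n ∨ (j : ℕ) = 0 then 0 else X i j

/-- The determinant of an element of `GL_n(F)`, as a unit of `F`. -/
def GLdet (h : Matrix.GeneralLinearGroup (Fin n) F) : Fˣ :=
  Units.map Matrix.detMonoidHom h

end ZhangRTF

namespace ZhangRTF

section helpers

variable {F : Type*} [Field F] {n : ℕ}

theorem emb_cc (h : Matrix (Fin n) (Fin n) F) (i j : Fin n) :
    emb h i.castSucc j.castSucc = h i j := by simp [emb]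

theorem emb_cl (h : Matrix (Fin n) (Fin n) F) (i : Fin n) :
    emb h i.castSucc (Fin.last n) = 0 := by simp [emb]

theorem emb_lc (h : Matrix (Fin n) (Fin n) F) (j : Fin n) :
    emb h (Fin.last n) j.castSucc = 0 := by simp [emb]

theorem emb_ll (h : Matrix (Fin n) (Fin n) F) :
    emb h (Fin.last n) (Fin.last n) = 1 := by simp [emb]

theorem emb_mul (g h : Matrix (Fin n) (Fin n) F) : emb (g * h) = emb g * emb h := by
  ext i j
  rw [Matrix.mul_apply, Fin.sum_univ_castSucc]
  refine Fin.lastCases ?_ (fun i => ?_) i <;> refine Fin.lastCases ?_ (fun j => ?_) j <;>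
    simp [emb_cc, emb_cl, emb_lc, emb_ll, Matrix.mul_apply]

theorem emb_one : emb (1 : Matrix (Fin n) (Fin n) F) = 1 := by
  ext i j
  refine Fin.lastCases ?_ (fun i => ?_) i <;> refine Fin.lastCases ?_ (fun j => ?_) j <;>
    simp [emb_cc, emb_cl, emb_lc, emb_ll, Matrix.one_apply, Fin.ext_iff]
  · intro h; omega
  · intro h; omega

theorem act_inv_act (h : Matrix.GeneralLinearGroup (Fin n) F)
    (X : Matrix (Fin (n + 1)) (Fin (n + 1)) F) : act h⁻¹ (act h X) = X := by
  have h1 : emb ((h⁻¹ : Matrix.GeneralLinearGroup (Fin n) F) : Matrix (Fin n) (Fin n) F) *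
      emb (h : Matrix (Fin n) (Fin n) F) = 1 := by
    rw [← emb_mul, Units.inv_mul, emb_one]
  unfold act
  rw [inv_inv]
  calc _ = (emb ((h⁻¹ : Matrix.GeneralLinearGroup (Fin n) F) : Matrix (Fin n) (Fin n) F) *
      emb (h : Matrix (Fin n) (Fin n) F)) * X *
      (emb ((h⁻¹ : Matrix.GeneralLinearGroup (Fin n) F) : Matrix (Fin n) (Fin n) F) *
      emb (h : Matrix (Fin n) (Fin n) F)) := by simp only [Matrix.mul_assoc]
    _ = X := by rw [h1, Matrix.one_mul, Matrix.mul_one]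

theorem blockA_act (h : Matrix.GeneralLinearGroup (Fin n) F)
    (X : Matrix (Fin (n + 1)) (Fin (n + 1)) F) :
    blockA (act h X) = (h : Matrix (Fin n) (Fin n) F) * blockA X *
      ((h⁻¹ : Matrix.GeneralLinearGroup (Fin n) F) : Matrix (Fin n) (Fin n) F) := by
  ext i j
  simp only [blockA, act, Matrix.of_apply, Matrix.mul_apply, Fin.sum_univ_castSucc, emb_cc,
    emb_cl, emb_lc, mul_zero, zero_mul, add_zero]

theorem blockU_act (h : Matrix.GeneralLinearGroup (Fin n) F)
    (X : Matrix (Fin (n + 1)) (Fin (n + 1)) F) :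
    blockU (act h X) = (h : Matrix (Fin n) (Fin n) F) *ᵥ blockU X := by
  ext i
  simp only [blockU, act, Matrix.mul_apply, Fin.sum_univ_castSucc, emb_cc,
    emb_cl, emb_ll, mul_zero, zero_mul, add_zero, mul_one, Matrix.mulVec, dotProduct,
    Finset.sum_const_zero, zero_add]

theorem deltaPlus_act (h : Matrix.GeneralLinearGroup (Fin n) F)
    (X : Matrix (Fin (n + 1)) (Fin (n + 1)) F) :
    deltaPlus (act h X) = (h : Matrix (Fin n) (Fin n) F) * deltaPlus X := by
  ext i j
  simp only [deltaPlus, Matrix.of_apply, blockA_act, blockU_act]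
  rw [Units.conj_pow, Matrix.mulVec_mulVec, Matrix.mul_assoc, Units.inv_mul, Matrix.mul_one,
    ← Matrix.mulVec_mulVec]
  rfl

theorem sigma_pow (a : Fin n → F) (b : Fin (n + 1) → F) (k : ℕ) (hk : k < n) :
    blockA (sectSigma a b) ^ k *ᵥ blockU (sectSigma a b) =
      Pi.single (⟨n - 1 - k, by omega⟩ : Fin n) 1 := by
  induction k with
  | zero =>
    rw [pow_zero, Matrix.one_mulVec]
    ext i
    have hi := i.isLt
    by_cases h : i = ⟨n - 1 - 0, by omega⟩
    · rw [h, Pi.single_eq_same]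
      have h1 : n ≠ 0 := by omega
      have h2 : n = n - 1 + 1 := by omega
      simp [blockU, sectSigma, h1, ← h2]
    · rw [Pi.single_eq_of_ne h]
      have h' : (i : ℕ) ≠ n - 1 := fun h3 => h (Fin.ext h3)
      have h1 : n ≠ 0 := by omega
      have h2 : ¬ n = i + 1 := by omega
      simp [blockU, sectSigma, h1, h2]
  | succ k ih =>
    rw [pow_succ', ← Matrix.mulVec_mulVec, ih (by omega), Matrix.mulVec_single_one]
    ext i
    have hi := i.isLt
    have h1 : n - 1 - k ≠ 0 := by omega
    by_cases h : i = ⟨n - 1 - (k + 1), by omega⟩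
    · rw [h, Pi.single_eq_same]
      have h2 : n - 1 - k = n - 1 - (k + 1) + 1 := by omega
      have h3 : n - 1 - (k + 1) < n := by omega
      simp only [Matrix.col_apply, blockA, sectSigma, Matrix.of_apply, Fin.val_castSucc]
      rw [dif_pos h3, if_neg h1, if_pos h2, zero_add]
    · rw [Pi.single_eq_of_ne h]
      have h' : (i : ℕ) ≠ n - 1 - (k + 1) := fun h3 => h (Fin.ext h3)
      have h2 : ¬ n - 1 - k = i + 1 := by omega
      simp only [Matrix.col_apply, blockA, sectSigma, Matrix.of_apply, Fin.val_castSucc]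
      rw [dif_pos hi, if_neg h1, if_neg h2, zero_add]

theorem deltaPlus_sigma (a : Fin n → F) (b : Fin (n + 1) → F) :
    deltaPlus (sectSigma a b) = 1 := by
  ext i j
  have hj := j.isLt
  simp only [deltaPlus, Matrix.of_apply]
  rw [sigma_pow a b _ (by omega), Matrix.one_apply, Pi.single_apply]
  congr 1
  rw [Fin.ext_iff, Fin.ext_iff, eq_iff_iff]
  simp only
  omega

/-- Recover the parameters from a section matrix. -/
def sigmaRead (X : Matrix (Fin (n + 1)) (Fin (n + 1)) F) : (Fin n → F) × (Fin (n + 1) → F) :=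
  (fun i => X i.castSucc 0, fun j => X (Fin.last n) j.rev)

theorem sigmaRead_sigma (a : Fin n → F) (b : Fin (n + 1) → F) :
    sigmaRead (sectSigma a b) = (a, b) := by
  simp [sigmaRead, sectSigma]

/-- `δ₊(X)` as an element of `GL_n`. -/
noncomputable def deltaGL (X : {X : Matrix (Fin (n + 1)) (Fin (n + 1)) F // DeltaPlus X ≠ 0}) :
    Matrix.GeneralLinearGroup (Fin n) F where
  val := deltaPlus X.1
  inv := (DeltaPlus X.1)⁻¹ • (deltaPlus X.1).adjugate
  val_inv := by
    rw [Matrix.mul_smul, Matrix.mul_adjugate, smul_smul]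
    exact (congrArg (· • (1 : Matrix (Fin n) (Fin n) F)) (inv_mul_cancel₀ X.2)).trans (one_smul _ _)
  inv_val := by
    rw [Matrix.smul_mul, Matrix.adjugate_mul, smul_smul]
    exact (congrArg (· • (1 : Matrix (Fin n) (Fin n) F)) (inv_mul_cancel₀ X.2)).trans (one_smul _ _)

variable [TopologicalSpace F] [IsTopologicalRing F]

theorem continuous_emb : Continuous (emb : Matrix (Fin n) (Fin n) F → _) := by
  refine continuous_matrix fun i j => ?_
  refine Fin.lastCases ?_ (fun i => ?_) i <;> refine Fin.lastCases ?_ (fun j => ?_) j <;>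
    simp only [emb_cc, emb_cl, emb_lc, emb_ll]
  · exact continuous_const
  · exact continuous_const
  · exact continuous_const
  · exact continuous_id.matrix_elem i j

theorem continuous_act : Continuous (fun p : Matrix.GeneralLinearGroup (Fin n) F ×
    Matrix (Fin (n + 1)) (Fin (n + 1)) F => act p.1 p.2) := by
  unfold act
  refine Continuous.mul (Continuous.mul ?_ continuous_snd) ?_
  · exact continuous_emb.comp (Units.continuous_val.comp continuous_fst)
  · exact continuous_emb.comp (Units.continuous_val.comp (continuous_inv.comp continuous_fst))

theorem continuous_sigma : Continuous (fun p : (Fin n → F) × (Fin (n + 1) → F) =>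
    sectSigma p.1 p.2) := by
  refine continuous_matrix fun i j => ?_
  simp only [sectSigma, Matrix.of_apply]
  split_ifs <;> fun_prop

theorem continuous_act_sigma : Continuous (fun q : ((Fin n → F) × (Fin (n + 1) → F)) ×
    Matrix.GeneralLinearGroup (Fin n) F => act q.2 (sectSigma q.1.1 q.1.2)) := by
  have h1 : Continuous (fun q : ((Fin n → F) × (Fin (n + 1) → F)) ×
      Matrix.GeneralLinearGroup (Fin n) F => sectSigma q.1.1 q.1.2) :=
    continuous_sigma.comp continuous_fst
  unfold act
  refine Continuous.mul (Continuous.mul ?_ h1) ?_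
  · exact continuous_emb.comp (Units.continuous_val.comp continuous_snd)
  · exact continuous_emb.comp (Units.continuous_val.comp (continuous_inv.comp continuous_snd))

theorem continuous_act_left (X : Matrix (Fin (n + 1)) (Fin (n + 1)) F) :
    Continuous (fun h : Matrix.GeneralLinearGroup (Fin n) F => act h X) := by
  unfold act
  refine Continuous.mul (Continuous.mul ?_ continuous_const) ?_
  · exact continuous_emb.comp Units.continuous_val
  · exact continuous_emb.comp (Units.continuous_val.comp continuous_inv)

theorem continuous_act_inv : Continuous (fun p : Matrix.GeneralLinearGroup (Fin n) F ×
    Matrix (Fin (n + 1)) (Fin (n + 1)) F => act p.1⁻¹ p.2) := by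
  unfold act
  refine Continuous.mul (Continuous.mul ?_ continuous_snd) ?_
  · exact continuous_emb.comp (Units.continuous_val.comp (continuous_inv.comp continuous_fst))
  · simp only [inv_inv]
    exact continuous_emb.comp (Units.continuous_val.comp continuous_fst)

theorem continuous_sigmaRead : Continuous (sigmaRead (F := F) (n := n)) := by
  unfold sigmaRead
  refine Continuous.prodMk (continuous_pi fun i => ?_) (continuous_pi fun i => ?_)
  · exact continuous_id.matrix_elem _ _
  · exact continuous_id.matrix_elem _ _

theorem continuous_deltaPlus : Continuous (deltaPlus (F := F) (n := n)) := by
  have hA : Continuous (blockA (F := F) (n := n)) :=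
    continuous_matrix fun i j => continuous_id.matrix_elem _ _
  have hU : Continuous (blockU (F := F) (n := n)) :=
    continuous_pi fun i => continuous_id.matrix_elem _ _
  refine continuous_matrix fun i j => ?_
  simp only [deltaPlus, Matrix.of_apply]
  exact (continuous_apply i).comp ((hA.pow _).matrix_mulVec hU)

theorem continuous_deltaGL [ContinuousInv₀ F] : Continuous (deltaGL (F := F) (n := n)) := by
  rw [Units.continuous_iff]
  have h1 : Continuous fun X : {X : Matrix (Fin (n + 1)) (Fin (n + 1)) F // DeltaPlus X ≠ 0} =>
    deltaPlus X.1 := continuous_deltaPlus.comp continuous_subtype_val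
  refine ⟨h1, ?_⟩
  change Continuous fun X : {X : Matrix (Fin (n + 1)) (Fin (n + 1)) F // DeltaPlus X ≠ 0} =>
    (DeltaPlus X.1)⁻¹ • (deltaPlus X.1).adjugate
  exact (h1.matrix_det.inv₀ fun X => X.2).smul h1.matrix_adjugate

theorem continuous_GLdet : Continuous (GLdet (F := F) (n := n)) :=
  Continuous.units_map _ (continuous_id.matrix_det)

/-- The compact set of `GL_n` which controls all the integrands. -/
theorem exists_compact [ContinuousInv₀ F] {K : Set (Matrix (Fin (n + 1)) (Fin (n + 1)) F)}
    (hK : IsCompact K) (hK' : K ⊆ {X | DeltaPlus X ≠ 0}) :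
    ∃ C : Set (Matrix.GeneralLinearGroup (Fin n) F), IsCompact C ∧
      ∀ h a b, act h (sectSigma a b) ∈ K → h ∈ C := by
  have hc : IsCompact (Subtype.val ⁻¹' K :
      Set {X : Matrix (Fin (n + 1)) (Fin (n + 1)) F // DeltaPlus X ≠ 0}) := by
    rw [Subtype.isCompact_iff, Set.image_preimage_eq_of_subset]
    · exact hK
    · intro X hX
      exact ⟨⟨X, hK' hX⟩, rfl⟩
  refine ⟨_, hc.image continuous_deltaGL, fun h a b hm => ⟨⟨_, hK' hm⟩, hm, ?_⟩⟩
  ext1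
  change deltaPlus _ = _
  rw [deltaPlus_act, deltaPlus_sigma, Matrix.mul_one]

end helpers

end ZhangRTF

open ZhangRTF

theorem orbital_generic {n : ℕ} {F : Type*} [Field F] [TopologicalSpace F] [IsTopologicalRing F]
    [ContinuousInv₀ F] [T2Space F]
    [MeasurableSpace (Matrix.GeneralLinearGroup (Fin n) F)]
    [BorelSpace (Matrix.GeneralLinearGroup (Fin n) F)]
    (μ : Measure (Matrix.GeneralLinearGroup (Fin n) F)) [IsFiniteMeasureOnCompacts μ]
    (η : Fˣ →* ℂˣ) (hη_cont : Continuous η)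
    (f : Matrix (Fin (n + 1)) (Fin (n + 1)) F → ℂ)
    (hf_lc : IsLocallyConstant f) (hf_supp : HasCompactSupport f)
    (hf_plus : Function.support f ⊆ {X | DeltaPlus X ≠ 0}) :
    (∀ (a : Fin n → F) (b : Fin (n + 1) → F),
      Integrable (fun h : Matrix.GeneralLinearGroup (Fin n) F =>
        f (act h (sectSigma a b)) * ((η (GLdet h) : ℂˣ) : ℂ)) μ) ∧
    IsLocallyConstant (fun p : (Fin n → F) × (Fin (n + 1) → F) =>
      ∫ h : Matrix.GeneralLinearGroup (Fin n) F, f (act h (sectSigma p.1 p.2)) * ((η (GLdet h) : ℂˣ) : ℂ) ∂μ) ∧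
    HasCompactSupport (fun p : (Fin n → F) × (Fin (n + 1) → F) =>
      ∫ h : Matrix.GeneralLinearGroup (Fin n) F, f (act h (sectSigma p.1 p.2)) * ((η (GLdet h) : ℂˣ) : ℂ) ∂μ) := by
  have hcl : IsClosed (Function.support f) := (hf_lc.isClopen_fiber 0).compl.isClosed
  have hK : IsCompact (Function.support f) := by
    have h := hf_supp.isCompact
    rwa [tsupport, hcl.closure_eq] at h
  obtain ⟨C, hC, hCmem⟩ := exists_compact hK hf_plus
  have hzero : ∀ (h : Matrix.GeneralLinearGroup (Fin n) F) (a : Fin n → F) (b : Fin (n + 1) → F),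
      h ∉ C → f (act h (sectSigma a b)) = 0 := by
    intro h a b hh
    by_contra hne
    exact hh (hCmem h a b hne)
  have hact : Continuous (fun q : ((Fin n → F) × (Fin (n + 1) → F)) ×
      Matrix.GeneralLinearGroup (Fin n) F => act q.2 (sectSigma q.1.1 q.1.2)) :=
    continuous_act_sigma
  refine ⟨fun a b => ?_, ?_, ?_⟩
  · refine Continuous.integrable_of_hasCompactSupport ?_ ?_
    · refine Continuous.mul ?_ ?_
      · exact hf_lc.continuous.comp (continuous_act_left (sectSigma a b))
      · exact Units.continuous_val.comp (hη_cont.comp continuous_GLdet)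
    · refine HasCompactSupport.intro hC fun h hh => ?_
      rw [hzero h a b hh, zero_mul]
  · rw [IsLocallyConstant.iff_eventually_eq]
    intro p
    have hev : ∀ᶠ q in nhds p, ∀ h ∈ C,
        f (act h (sectSigma q.1 q.2)) = f (act h (sectSigma p.1 p.2)) := by
      refine hC.eventually_forall_of_forall_eventually fun h _ => ?_
      have hlc := hf_lc.comp_continuous hact
      have h1 := (IsLocallyConstant.iff_eventually_eq _).1 hlc (p, h)
      have h2 : Filter.Tendsto (fun z : ((Fin n → F) × (Fin (n + 1) → F)) ×
          Matrix.GeneralLinearGroup (Fin n) F => (p, z.2)) (nhds (p, h)) (nhds (p, h)) :=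
        (Continuous.prodMk continuous_const continuous_snd).tendsto (p, h)
      have h3 := h2.eventually h1
      filter_upwards [h1, h3] with z hz1 hz3
      exact hz1.trans hz3.symm
    filter_upwards [hev] with q hq
    refine integral_congr_ae (Filter.Eventually.of_forall fun h => ?_)
    by_cases hh : h ∈ C
    · simp only [hq h hh]
    · simp only [hzero h _ _ hh]
  · have hD : IsCompact ((fun q : Matrix.GeneralLinearGroup (Fin n) F ×
        Matrix (Fin (n + 1)) (Fin (n + 1)) F => sigmaRead (act q.1⁻¹ q.2)) ''
        (C ×ˢ Function.support f)) := by
      refine (hC.prod hK).image (continuous_sigmaRead.comp continuous_act_inv)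
    refine HasCompactSupport.intro hD fun p hp => ?_
    refine integral_eq_zero_of_ae (Filter.Eventually.of_forall fun h => ?_)
    by_cases hne : f (act h (sectSigma p.1 p.2)) = 0
    · simp only [hne, zero_mul, Pi.zero_apply]
    · refine absurd ⟨(h, act h (sectSigma p.1 p.2)), ⟨hCmem h _ _ hne, hne⟩, ?_⟩ hp
      simp only [act_inv_act, sigmaRead_sigma]

/-- For `f` supported in `M_{n+1,+}`, the orbital integrals along the section `σ`
converge and define a locally constant compactly supported function of the invariants. -/
theorem orbital_integral_locally_constant    (n : ℕ) (hn : 1 ≤ n)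
    (F : Type*) [NontriviallyNormedField F] [CompleteSpace F] [CharZero F]
    [IsUltrametricDist F] [LocallyCompactSpace F]
    [MeasurableSpace F] [BorelSpace F]
    (μF : Measure F) [MeasureTheory.Measure.IsAddHaarMeasure μF]
    (hμF : ∀ a : F, a ≠ 0 → ∀ S : Set F,
      μF ((fun x => a * x) '' S) = ENNReal.ofReal ‖a‖ * μF S)
    [MeasurableSpace (Matrix.GeneralLinearGroup (Fin n) F)] [BorelSpace (Matrix.GeneralLinearGroup (Fin n) F)]
    (μ : Measure (Matrix.GeneralLinearGroup (Fin n) F)) [MeasureTheory.Measure.IsHaarMeasure μ]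
    (η : Fˣ →* ℂˣ) (hη_cont : Continuous η) (hη_quad : ∀ x, η x * η x = 1)
    (f : Matrix (Fin (n + 1)) (Fin (n + 1)) F → ℂ)
    (hf_lc : IsLocallyConstant f) (hf_supp : HasCompactSupport f)
    (hf_plus : Function.support f ⊆ {X | DeltaPlus X ≠ 0}) :
    (∀ (a : Fin n → F) (b : Fin (n + 1) → F),
      Integrable (fun h : Matrix.GeneralLinearGroup (Fin n) F =>
        f (act h (sectSigma a b)) * ((η (GLdet h) : ℂˣ) : ℂ)) μ) ∧
    IsLocallyConstant (fun p : (Fin n → F) × (Fin (n + 1) → F) =>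
      ∫ h : Matrix.GeneralLinearGroup (Fin n) F, f (act h (sectSigma p.1 p.2)) * ((η (GLdet h) : ℂˣ) : ℂ) ∂μ) ∧
    HasCompactSupport (fun p : (Fin n → F) × (Fin (n + 1) → F) =>
      ∫ h : Matrix.GeneralLinearGroup (Fin n) F, f (act h (sectSigma p.1 p.2)) * ((η (GLdet h) : ℂˣ) : ℂ) ∂μ) := by
  exact orbital_generic μ η hη_cont f hf_lc hf_supp hf_plus
end

section
/- (Regularity on M_{n+1,+}) If X ∈ M_{n+1}(F) satisfies Δ_+(X) ≠ 0 or Δ_−(X) ≠ 0, then the stabilizer of X in GL_n(F) is trivial: for every h ∈ GL_n(F), h·X = X implies h = 1. -/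
open Matrix MeasureTheory

open ZhangRTF

theorem aux_emb_mul {F : Type*} [Field F] {n : ℕ} (a b : Matrix (Fin n) (Fin n) F) :
    emb a * emb b = emb (a * b) := by
  ext i j
  refine Fin.lastCases ?_ (fun i => ?_) i <;> refine Fin.lastCases ?_ (fun j => ?_) j <;>
    simp [emb, Matrix.mul_apply, Fin.sum_univ_castSucc]

theorem aux_emb_one {F : Type*} [Field F] {n : ℕ} :
    emb (1 : Matrix (Fin n) (Fin n) F) = 1 := by
  ext i j
  refine Fin.lastCases ?_ (fun i => ?_) i <;> refine Fin.lastCases ?_ (fun j => ?_) j <;>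
    simp [emb, Matrix.one_apply, Fin.ext_iff]
  · omega
  · omega

/-- If `Δ₊(X) ≠ 0` or `Δ₋(X) ≠ 0`, then the stabilizer of `X` in `GL_n(F)` is trivial. -/
theorem trivial_stabilizer (n : ℕ) (hn : 1 ≤ n) (F : Type*) [Field F]
    (X : Matrix (Fin (n + 1)) (Fin (n + 1)) F)
    (hX : DeltaPlus X ≠ 0 ∨ DeltaMinus X ≠ 0) :
    ∀ h : Matrix.GeneralLinearGroup (Fin n) F, act h X = X → h = 1 := by
  intro h hh
  have hc : emb (h : Matrix (Fin n) (Fin n) F) * X = X * emb (h : Matrix (Fin n) (Fin n) F) := by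
    have h1 : emb ((h⁻¹ : Matrix.GeneralLinearGroup (Fin n) F) : Matrix (Fin n) (Fin n) F) *
        emb (h : Matrix (Fin n) (Fin n) F) = 1 := by
      rw [aux_emb_mul, ← Units.val_mul, inv_mul_cancel, Units.val_one, aux_emb_one]
    conv_rhs => rw [← hh, act, Matrix.mul_assoc, h1, Matrix.mul_one]
  have hA : (h : Matrix (Fin n) (Fin n) F) * blockA X = blockA X * h := by
    ext i j
    have := congrFun (congrFun hc i.castSucc) j.castSucc
    simpa [emb, blockA, Matrix.mul_apply, Fin.sum_univ_castSucc] using this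
  have hU : (h : Matrix (Fin n) (Fin n) F) *ᵥ blockU X = blockU X := by
    ext i
    have := congrFun (congrFun hc i.castSucc) (Fin.last n)
    simpa [emb, blockU, Matrix.mul_apply, Matrix.mulVec, dotProduct, Fin.sum_univ_castSucc]
      using this
  have hV : blockV X ᵥ* (h : Matrix (Fin n) (Fin n) F) = blockV X := by
    ext i
    have := congrFun (congrFun hc (Fin.last n)) i.castSucc
    simpa [emb, blockV, Matrix.mul_apply, Matrix.vecMul, dotProduct, Fin.sum_univ_castSucc]
      using this.symm
  have hP : ∀ k : ℕ, (h : Matrix (Fin n) (Fin n) F) * blockA X ^ k = blockA X ^ k * h :=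
    fun k => ((show Commute (h : Matrix (Fin n) (Fin n) F) (blockA X) from hA).pow_right k).eq
  apply Units.ext
  rw [Units.val_one]
  rcases hX with hX | hX
  · have hu : IsUnit (deltaPlus X) :=
      (Matrix.isUnit_iff_isUnit_det _).2 (isUnit_iff_ne_zero.2 hX)
    apply hu.mul_right_cancel
    rw [one_mul]
    ext i j
    have := congrFun (show (h : Matrix (Fin n) (Fin n) F) *ᵥ
        (blockA X ^ (n - 1 - (j : ℕ)) *ᵥ blockU X) = blockA X ^ (n - 1 - (j : ℕ)) *ᵥ blockU X by
      rw [Matrix.mulVec_mulVec, hP, ← Matrix.mulVec_mulVec, hU]) i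
    exact this
  · have hu : IsUnit (deltaMinus X) :=
      (Matrix.isUnit_iff_isUnit_det _).2 (isUnit_iff_ne_zero.2 hX)
    apply hu.mul_left_cancel
    rw [mul_one]
    ext i j
    have := congrFun (show (blockV X ᵥ* blockA X ^ (i : ℕ)) ᵥ* (h : Matrix (Fin n) (Fin n) F)
        = blockV X ᵥ* blockA X ^ (i : ℕ) by
      rw [Matrix.vecMul_vecMul, ← hP, ← Matrix.vecMul_vecMul, hV]) j
    exact this
end
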